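/- Let X be a Banach space and K : X → X a compact linear operator. Then I - K is injective if and only if it is surjective. -/

import Mathlib

open Filter in
/-- If `K` is a compact operator on a normed space and `1 - K` is surjective, then it is
injective. -/
theorem IsCompactOperator.injective_one_sub_of_surjective {𝕜 X : Type*}
    [NontriviallyNormedField 𝕜] [NormedAddCommGroup X] [NormedSpace 𝕜 X] {K : X →L[𝕜] X}
    (hK : IsCompactOperator K) (hsurj : Function.Surjective ((1 : X →L[𝕜] X) - K)) :
    Function.Injective ((1 : X →L[𝕜] X) - K) := by
  set S : X →L[𝕜] X := 1 - K with hS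
  by_contra hinj
  obtain ⟨z, hz, hz0⟩ : ∃ z, S z = 0 ∧ z ≠ 0 := by
    rw [injective_iff_map_eq_zero] at hinj
    push Not at hinj
    exact hinj
  have hsucc (n : ℕ) (x : X) : (S ^ (n + 1)) x = (S ^ n) (S x) := by
    rw [pow_succ]; rfl
  have hsucc' (n : ℕ) (x : X) : (S ^ (n + 1)) x = S ((S ^ n) x) := by
    rw [pow_succ']; rfl
  have hpow_surj (n : ℕ) : Function.Surjective (S ^ n) := by
    rw [FunLike.coe_pow_eq_iterate]
    exact hsurj.iterate n
  have hmono {m n : ℕ} (hmn : m ≤ n) {x : X} (hx : (S ^ m) x = 0) : (S ^ n) x = 0 := by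
    induction n, hmn using Nat.le_induction with
    | base => exact hx
    | succ n _ ih => rw [hsucc', ih, map_zero]
  -- Riesz's lemma inside the strictly increasing sequence of closed subspaces `ker (S ^ n)`.
  obtain ⟨c, hc⟩ := NormedField.exists_one_lt_norm 𝕜
  have hriesz (n : ℕ) : ∃ x, (S ^ (n + 1)) x = 0 ∧ ‖x‖ ≤ ‖c‖ + 1 ∧
      ∀ y, (S ^ n) y = 0 → 1 ≤ ‖x - y‖ := by
    let F := (S ^ n).ker.comap (S ^ (n + 1)).ker.subtype
    have hF : IsClosed (F : Set (S ^ (n + 1)).ker) :=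
      (S ^ n).isClosed_ker.preimage continuous_subtype_val
    have hF' : ∃ x, x ∉ F := by
      obtain ⟨x, hx⟩ := hpow_surj n z
      refine ⟨⟨x, ?_⟩, ?_⟩
      · change (S ^ (n + 1)) x = 0
        rw [hsucc', hx, hz]
      · change ¬ (S ^ n) x = 0
        rwa [hx]
    obtain ⟨⟨x, hx⟩, hxn, hxy⟩ := riesz_lemma_of_norm_lt hc (lt_add_one ‖c‖) hF hF'
    exact ⟨x, hx, hxn, fun y hy ↦ hxy ⟨y, hmono n.le_succ hy⟩ hy⟩
  choose f hf_mem hf_norm hf_far using hriesz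
  have hsep {m n : ℕ} (hmn : m < n) : 1 ≤ ‖K (f n) - K (f m)‖ := by
    have h : K (f n) - K (f m) = f n - (S (f n) + f m - S (f m)) := by
      simp only [hS, sub_apply, one_apply_eq_self]
      abel
    rw [h]
    refine hf_far n _ ?_
    have hm : (S ^ n) (f m) = 0 := hmono hmn (hf_mem m)
    rw [map_sub, map_add, ← hsucc, hf_mem, hm, ← hsucc, hsucc', hm, map_zero]
    simp
  -- The images `K (f n)` lie in a compact set, so they cannot be uniformly separated.
  obtain ⟨C, hC, hC'⟩ := hK.image_closedBall_subset_compact (f := (K : X →ₗ[𝕜] X)) (‖c‖ + 1)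
  obtain ⟨y, -, ψ, hψ, hψy⟩ := hC.tendsto_subseq (x := fun n ↦ K (f n))
    fun n ↦ hC' ⟨f n, by simpa using hf_norm n, rfl⟩
  obtain ⟨N, hN⟩ := Metric.cauchySeq_iff'.mp hψy.cauchySeq 1 one_pos
  have hlt : ‖K (f (ψ (N + 1))) - K (f (ψ N))‖ < 1 := by
    simpa [dist_eq_norm_sub] using hN (N + 1) N.le_succ
  exact hlt.not_ge (hsep (hψ N.lt_succ_self))

/-- If `K` is a compact operator on a Banach space and `1 - K` is injective, then it is
surjective. -/
theorem IsCompactOperator.surjective_one_sub_of_injective {𝕜 X : Type*}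
    [NontriviallyNormedField 𝕜] [NormedAddCommGroup X] [NormedSpace 𝕜 X] [CompleteSpace X]
    {K : X →L[𝕜] X} (hK : IsCompactOperator K)
    (hinj : Function.Injective ((1 : X →L[𝕜] X) - K)) :
    Function.Surjective ((1 : X →L[𝕜] X) - K) := by
  rcases hK.hasEigenvalue_or_mem_resolventSet (one_ne_zero (α := 𝕜)) with h | h
  · obtain ⟨x, hx⟩ := h.exists_hasEigenvector
    have hKx : K x = x := by simpa using hx.apply_eq_smul
    refine absurd (hinj ?_) hx.2
    simp [hKx]
  · rw [spectrum.mem_resolventSet_iff, map_one, ContinuousLinearMap.isUnit_iff_bijective] at h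
    exact h.surjective

theorem stmt_4 {X : Type*} [NormedAddCommGroup X] [NormedSpace ℝ X] [CompleteSpace X]
    (K : X →L[ℝ] X) (hK : IsCompactOperator K) :
    Function.Injective ((1 : X →L[ℝ] X) - K) ↔
      Function.Surjective ((1 : X →L[ℝ] X) - K) :=
  ⟨hK.surjective_one_sub_of_injective, hK.injective_one_sub_of_surjective⟩
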